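/- arXiv:2601.21052 — 4 statements merged into one kernel-verified Lean document; each statement's English description precedes it below -/
import Mathlib

section
/- Let F be an antitone and exhaustive filtration on a K-vector space V, and let ε : K[x,x⁻¹] ⊗_K V → V be the K-linear map determined by p ⊗ v ↦ p(1)·v (evaluation of Laurent polynomials at x = 1). Then ε maps the Rees module R(V,F) onto V, and the kernel of ε intersected with R(V,F) equals (x−1)·R(V,F), i.e., the submodule Ideal.span{x−1} • R(V,F). -/
open Polynomial LaurentPolynomial TensorProduct DirectSum

noncomputable instance (K : Type*) [Field K] :
    IsScalarTower K (Polynomial K) (LaurentPolynomial K) :=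
  IsScalarTower.of_algebraMap_eq fun c => by
    simp [LaurentPolynomial.algebraMap_eq_toLaurent]

noncomputable instance (K : Type*) [Field K] :
    SMulCommClass K (Polynomial K) (LaurentPolynomial K) :=
  IsScalarTower.to_smulCommClass

noncomputable instance (priority := 1100) (K : Type*) [Field K] (V : Type*) [AddCommGroup V]
    [Module K V] : AddCommGroup (LaurentPolynomial K ⊗[K] V) :=
  TensorProduct.addCommGroup

/-- The `K`-linear map `μ m : v ↦ x^m ⊗ v` from `V` to `K[x,x⁻¹] ⊗[K] V`. -/
noncomputable def mu (K : Type*) [Field K] (V : Type*) [AddCommGroup V] [Module K V] (m : ℤ) :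
    V →ₗ[K] LaurentPolynomial K ⊗[K] V :=
  TensorProduct.mk K (LaurentPolynomial K) V (LaurentPolynomial.T m)

/-- The Rees module of a filtration `F`: the `K[x]`-submodule of `K[x,x⁻¹] ⊗[K] V`
generated by the elements `x^(-i) ⊗ v` with `i : ℤ` and `v ∈ F i`. -/
noncomputable def ReesModule (K : Type*) [Field K] (V : Type*) [AddCommGroup V] [Module K V]
    (F : ℤ → Submodule K V) : Submodule (Polynomial K) (LaurentPolynomial K ⊗[K] V) :=
  Submodule.span (Polynomial K)
    {z | ∃ (i : ℤ) (v : V), v ∈ F i ∧ z = LaurentPolynomial.T (-i) ⊗ₜ[K] v}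

theorem X_pow_smul_T_tmul {K : Type*} [Field K] {V : Type*} [AddCommGroup V] [Module K V]
    (k : ℕ) (n : ℤ) (v : V) :
    (X ^ k : K[X]) • ((T n : K[T;T⁻¹]) ⊗ₜ[K] v) = (T (n + k) : K[T;T⁻¹]) ⊗ₜ[K] v := by
  rw [TensorProduct.smul_tmul', Algebra.smul_def, LaurentPolynomial.algebraMap_eq_toLaurent,
    Polynomial.toLaurent_X_pow, ← LaurentPolynomial.T_add, add_comm]

theorem C_smul_laurentPolynomial_tensor {K : Type*} [Field K] {V : Type*} [AddCommGroup V]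
    [Module K V] (a : K) (z : K[T;T⁻¹] ⊗[K] V) : (Polynomial.C a : K[X]) • z = a • z := by
  rw [← Polynomial.algebraMap_eq, algebraMap_smul]

/-- A `K`-linear map sending each `x^n ⊗ v` to `v` is semilinear along evaluation at `1`. -/
theorem map_polynomial_smul_of_map_T_tmul {K : Type*} [Field K] {V : Type*} [AddCommGroup V]
    [Module K V] (ε : K[T;T⁻¹] ⊗[K] V →ₗ[K] V) (hε : ∀ (n : ℤ) (v : V), ε (T n ⊗ₜ[K] v) = v)
    (p : K[X]) (z : K[T;T⁻¹] ⊗[K] V) : ε (p • z) = p.eval 1 • ε z := by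
  induction p using Polynomial.induction_on' with
  | add p q hp hq => rw [add_smul, map_add, hp, hq, Polynomial.eval_add, add_smul]
  | monomial k a =>
    rw [← Polynomial.C_mul_X_pow_eq_monomial, mul_smul, C_smul_laurentPolynomial_tensor, map_smul]
    simp only [Polynomial.eval_mul, Polynomial.eval_C, Polynomial.eval_pow, Polynomial.eval_X,
      one_pow, mul_one]
    congr 1
    induction z using TensorProduct.induction_on with
    | zero => simp
    | add y z hy hz => rw [smul_add, map_add, map_add, hy, hz]
    | tmul f v =>
      induction f using LaurentPolynomial.induction_on' with
      | add f g hf hg => rw [TensorProduct.add_tmul, smul_add, map_add, map_add, hf, hg]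
      | C_mul_T n b =>
        rw [← LaurentPolynomial.smul_eq_C_mul, TensorProduct.smul_tmul, X_pow_smul_T_tmul, hε, hε]

theorem smul_mem_span_X_sub_one_smul {K : Type*} [Field K] {M : Type*} [AddCommGroup M]
    [Module K[X] M] {N : Submodule K[X] M} {p : K[X]} (hp : p.eval 1 = 0) {z : M} (hz : z ∈ N) :
    p • z ∈ Ideal.span {(X - 1 : K[X])} • N := by
  refine Submodule.smul_mem_smul (Ideal.mem_span_singleton.2 ?_) hz
  simpa using Polynomial.dvd_iff_isRoot.2 hp

theorem T_tmul_mem_reesModule {K : Type*} [Field K] {V : Type*} [AddCommGroup V] [Module K V]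
    {F : ℤ → Submodule K V} {i : ℤ} {v : V} (hv : v ∈ F i) :
    (T (-i) : K[T;T⁻¹]) ⊗ₜ[K] v ∈ ReesModule K V F :=
  Submodule.subset_span ⟨i, v, hv, rfl⟩

/-- Modulo `(x - 1) • R(V,F)`, an element `z` of the Rees module is determined by its value
at `x = 1`. -/
theorem sub_T_tmul_mem_span_X_sub_one_smul {K : Type*} [Field K] {V : Type*} [AddCommGroup V]
    [Module K V] {F : ℤ → Submodule K V} {i : ℤ} (hi : F i = ⊤)
    (ε : K[T;T⁻¹] ⊗[K] V →ₗ[K] V) (hε : ∀ (n : ℤ) (v : V), ε (T n ⊗ₜ[K] v) = v)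
    {z : K[T;T⁻¹] ⊗[K] V} (hz : z ∈ ReesModule K V F) :
    z - (T (-i) : K[T;T⁻¹]) ⊗ₜ[K] ε z ∈
      Ideal.span {(X - 1 : K[X])} • ReesModule K V F := by
  have mem (v : V) : (T (-i) : K[T;T⁻¹]) ⊗ₜ[K] v ∈ ReesModule K V F :=
    T_tmul_mem_reesModule (hi ▸ Submodule.mem_top)
  induction hz using Submodule.span_induction with
  | zero => simp
  | add y z _ _ hy hz =>
    rw [map_add, TensorProduct.tmul_add, add_sub_add_comm]
    exact add_mem hy hz
  | smul p z _ hz =>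
    have h := add_mem (Submodule.smul_mem _ p hz)
      (smul_mem_span_X_sub_one_smul (p := p - Polynomial.C (p.eval 1)) (by simp) (mem (ε z)))
    rwa [smul_sub, sub_smul, C_smul_laurentPolynomial_tensor, sub_add_sub_cancel,
      ← TensorProduct.tmul_smul, ← map_polynomial_smul_of_map_T_tmul ε hε] at h
  | mem z hz =>
    obtain ⟨j, v, hv, rfl⟩ := hz
    rw [hε]
    rcases le_total i j with h | h
    · obtain ⟨k, rfl⟩ := Int.le.dest h
      have h := smul_mem_span_X_sub_one_smul (p := 1 - X ^ k) (by simp) (T_tmul_mem_reesModule hv)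
      rwa [sub_smul, one_smul, X_pow_smul_T_tmul, neg_add, neg_add_cancel_right, ← neg_add] at h
    · obtain ⟨k, rfl⟩ := Int.le.dest h
      have h := smul_mem_span_X_sub_one_smul (p := X ^ k - 1) (by simp) (mem v)
      rwa [sub_smul, one_smul, X_pow_smul_T_tmul, neg_add, neg_add_cancel_right, ← neg_add] at h

/-- for an antitone exhaustive filtration `F`, the evaluation-at-1 map
`ε : p ⊗ v ↦ p(1) • v` (characterized on monomials by `ε (x^n ⊗ v) = v`) maps the Rees
module onto `V`, and its kernel intersected with the Rees module is `(x-1) • R(V,F)`. -/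
theorem reesModule_eval_one_surjective_and_ker
    (K : Type*) [Field K] (V : Type*) [AddCommGroup V] [Module K V]
    (F : ℤ → Submodule K V) (hF : Antitone F) (hexh : ∃ i : ℤ, F i = ⊤)
    (ε : LaurentPolynomial K ⊗[K] V →ₗ[K] V)
    (hε : ∀ (n : ℤ) (v : V), ε (LaurentPolynomial.T n ⊗ₜ[K] v) = v) :
    (∀ v : V, ∃ z ∈ ReesModule K V F, ε z = v) ∧
      {z | z ∈ ReesModule K V F ∧ ε z = 0} =
        ((Ideal.span {(Polynomial.X - 1 : Polynomial K)} • ReesModule K V F :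
            Submodule (Polynomial K) (LaurentPolynomial K ⊗[K] V)) : Set _) := by
  obtain ⟨i, hi⟩ := hexh
  refine ⟨fun v => ⟨_, T_tmul_mem_reesModule (i := i) (hi ▸ Submodule.mem_top), hε _ v⟩, ?_⟩
  ext z
  refine ⟨fun ⟨hz, hz0⟩ => ?_, fun hz => ⟨Submodule.smul_le_right hz, ?_⟩⟩
  · simpa [hz0] using sub_T_tmul_mem_span_X_sub_one_smul hi ε hε hz
  · obtain ⟨y, -, rfl⟩ := Submodule.mem_smul_pointwise_iff_exists _ _ _ |>.1
      (Submodule.ideal_span_singleton_smul (X - 1 : K[X]) (ReesModule K V F) ▸ hz)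
    rw [map_polynomial_smul_of_map_T_tmul ε hε]
    simp
end

section
/- Let F be an antitone filtration on a K-vector space V and G an antitone filtration on a K-vector space W, and let f : V → W be a K-linear map. Then the K[x,x⁻¹]-linear map id ⊗ f : K[x,x⁻¹] ⊗_K V → K[x,x⁻¹] ⊗_K W maps the Rees module R(V,F) into the Rees module R(W,G) if and only if f maps F(i) into G(i) for every i ∈ ℤ (i.e., Submodule.map f (F i) ≤ G i for all i). -/
open Polynomial LaurentPolynomial TensorProduct DirectSum

/-- The `K`-linear map reading off the coefficient of `x^n` in `K[x,x⁻¹] ⊗[K] V`. -/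
noncomputable def tensorCoeff (K : Type*) [Field K] (V : Type*) [AddCommGroup V] [Module K V]
    (n : ℤ) : LaurentPolynomial K ⊗[K] V →ₗ[K] V :=
  TensorProduct.lift <| (LinearMap.lsmul K V).comp <|
    (Finsupp.lapply n).comp (AddMonoidAlgebra.coeffLinearEquiv K).toLinearMap

theorem tensorCoeff_tmul (K : Type*) [Field K] (V : Type*) [AddCommGroup V] [Module K V]
    (n : ℤ) (p : LaurentPolynomial K) (v : V) :
    tensorCoeff K V n (p ⊗ₜ[K] v) = p.coeff n • v :=
  rfl

theorem tensorCoeff_T_tmul (K : Type*) [Field K] (V : Type*) [AddCommGroup V] [Module K V]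
    (m n : ℤ) (v : V) :
    tensorCoeff K V n (LaurentPolynomial.T m ⊗ₜ[K] v) = if m = n then v else 0 := by
  rw [tensorCoeff_tmul, LaurentPolynomial.T, AddMonoidAlgebra.coeff_single, Finsupp.single_apply,
    ite_smul, one_smul, zero_smul]

theorem tensorCoeff_X_smul (K : Type*) [Field K] (V : Type*) [AddCommGroup V] [Module K V]
    (n : ℤ) (z : LaurentPolynomial K ⊗[K] V) :
    tensorCoeff K V n ((X : K[X]) • z) = tensorCoeff K V (n - 1) z := by
  induction z with
  | zero => simp
  | add y z hy hz => simp only [smul_add, map_add, hy, hz]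
  | tmul p v =>
    rw [TensorProduct.smul_tmul', tensorCoeff_tmul, tensorCoeff_tmul, Algebra.smul_def,
      LaurentPolynomial.algebraMap_eq_toLaurent, Polynomial.toLaurent_X, mul_comm]
    congr 1
    rw [LaurentPolynomial.T, AddMonoidAlgebra.coeff_mul_single_apply, mul_one, sub_eq_add_neg]

theorem tensorCoeff_C_smul (K : Type*) [Field K] (V : Type*) [AddCommGroup V] [Module K V]
    (n : ℤ) (a : K) (z : LaurentPolynomial K ⊗[K] V) :
    tensorCoeff K V n ((Polynomial.C a : K[X]) • z) = a • tensorCoeff K V n z := by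
  rw [← map_smul, ← Polynomial.algebraMap_eq, algebraMap_smul]

theorem tensorCoeff_smul_mem {K : Type*} [Field K] {V : Type*} [AddCommGroup V] [Module K V]
    {F : ℤ → Submodule K V} (hF : Antitone F) (p : K[X]) {z : LaurentPolynomial K ⊗[K] V}
    (hz : ∀ n, tensorCoeff K V (-n) z ∈ F n) (n : ℤ) :
    tensorCoeff K V (-n) (p • z) ∈ F n := by
  induction p using Polynomial.induction_on generalizing n with
  | C a => rw [tensorCoeff_C_smul]; exact (F n).smul_mem a (hz n)
  | add p q hp hq => rw [add_smul, map_add]; exact (F n).add_mem (hp n) (hq n)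
  | monomial k a ih =>
    rw [pow_succ', mul_left_comm, mul_smul, tensorCoeff_X_smul, ← neg_add']
    exact hF (by lia) (ih (n + 1))

theorem tensorCoeff_mem_of_mem_reesModule {K : Type*} [Field K] {V : Type*} [AddCommGroup V]
    [Module K V] {F : ℤ → Submodule K V} (hF : Antitone F) {z : LaurentPolynomial K ⊗[K] V}
    (hz : z ∈ ReesModule K V F) (n : ℤ) : tensorCoeff K V (-n) z ∈ F n := by
  induction hz using Submodule.span_induction generalizing n with
  | zero => simp
  | add y z _ _ hy hz => rw [map_add]; exact (F n).add_mem (hy n) (hz n)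
  | smul p z _ hz => exact tensorCoeff_smul_mem hF p hz n
  | mem z hz =>
    obtain ⟨i, v, hv, rfl⟩ := hz
    rw [tensorCoeff_T_tmul]
    split_ifs with h
    · exact neg_injective h ▸ hv
    · exact (F n).zero_mem

/-- `id ⊗ f` maps `R(V,F)` into `R(W,G)` if and only if `f` maps `F i`
into `G i` for every `i : ℤ`. -/
theorem baseChange_mapsTo_reesModule_iff
    (K : Type*) [Field K] (V : Type*) [AddCommGroup V] [Module K V]
    (W : Type*) [AddCommGroup W] [Module K W]
    (F : ℤ → Submodule K V) (hF : Antitone F)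
    (G : ℤ → Submodule K W) (hG : Antitone G)
    (f : V →ₗ[K] W) :
    (∀ z ∈ ReesModule K V F,
        f.baseChange (LaurentPolynomial K) z ∈ ReesModule K W G) ↔
      ∀ i : ℤ, (F i).map f ≤ G i := by
  constructor
  · rintro h i _ ⟨v, hv, rfl⟩
    have := tensorCoeff_mem_of_mem_reesModule hG
      (h (LaurentPolynomial.T (-i) ⊗ₜ[K] v) (Submodule.subset_span ⟨i, v, hv, rfl⟩)) i
    simpa [tensorCoeff_T_tmul] using this
  · intro h z hz
    let φ : LaurentPolynomial K ⊗[K] V →ₗ[K[X]] LaurentPolynomial K ⊗[K] W :=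
      TensorProduct.AlgebraTensorModule.map LinearMap.id f
    suffices ReesModule K V F ≤ (ReesModule K W G).comap φ from this hz
    refine Submodule.span_le.mpr ?_
    rintro _ ⟨i, v, hv, rfl⟩
    exact Submodule.subset_span ⟨i, f v, h i ⟨v, hv, rfl⟩, rfl⟩
end

section
/- Let V be a finite-dimensional K-vector space equipped with k antitone, exhaustive and separated filtrations F_1, …, F_k. Then the multigraded piece Gr_𝐧(V) is nonzero for only finitely many 𝐧 ∈ ℤ^k, and dim_K V ≤ Σ_{𝐧 ∈ ℤ^k} dim_K Gr_𝐧(V) (the sum being finite). -/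
open TensorProduct

/-- `A(𝐧) = ⨅ j, F j (𝐧 j)`, for a family of `k` filtrations on `V`. -/
abbrev multiA (K : Type*) [Field K] (V : Type*) [AddCommGroup V] [Module K V]
    {k : ℕ} (F : Fin k → ℤ → Submodule K V) (n : Fin k → ℤ) : Submodule K V :=
  ⨅ j : Fin k, F j (n j)

/-- `B(𝐧) = ⨆ j, A(𝐧 + e_j)`. -/
abbrev multiB (K : Type*) [Field K] (V : Type*) [AddCommGroup V] [Module K V]
    {k : ℕ} (F : Fin k → ℤ → Submodule K V) (n : Fin k → ℤ) : Submodule K V :=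
  ⨆ j : Fin k, multiA K V F (n + Pi.single j 1)

/-- The multigraded piece `Gr_𝐧(V) = A(𝐧) / (B(𝐧) ∩ A(𝐧))`: the quotient of `A(𝐧)` by
the submodule of `A(𝐧)` pulled back from `B(𝐧)`. -/
abbrev multiGr (K : Type*) [Field K] (V : Type*) [AddCommGroup V] [Module K V]
    {k : ℕ} (F : Fin k → ℤ → Submodule K V) (n : Fin k → ℤ) : Type _ :=
  ↥(multiA K V F n) ⧸ Submodule.comap (multiA K V F n).subtype (multiB K V F n)

theorem Submodule.finrank_finset_sup_le_sum {K V ι : Type*} [Field K] [AddCommGroup V]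
    [Module K V] [FiniteDimensional K V] (s : Finset ι) (C : ι → Submodule K V) :
    Module.finrank K ↥(s.sup C) ≤ ∑ i ∈ s, Module.finrank K (C i) := by
  classical
  induction s using Finset.induction_on with
  | empty => simp
  | insert a s ha ih =>
    rw [Finset.sup_insert, Finset.sum_insert ha]
    exact (Submodule.finrank_add_le_finrank_add_finrank _ _).trans (by gcongr)

/-- `P` is generated, up to elements of `Q`, by a submodule of the dimension of `P ⧸ (P ⊓ Q)`. -/
theorem Submodule.exists_le_sup_and_finrank_eq_quotient {K V : Type*} [Field K]
    [AddCommGroup V] [Module K V] (P Q : Submodule K V) :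
    ∃ C : Submodule K V, P ≤ C ⊔ Q ∧
      Module.finrank K C = Module.finrank K (P ⧸ Q.comap P.subtype) := by
  obtain ⟨C, hC⟩ := Submodule.exists_isCompl (Q.comap P.subtype)
  refine ⟨C.map P.subtype, ?_, ?_⟩
  · calc P = (C ⊔ Q.comap P.subtype).map P.subtype := by
          rw [hC.symm.sup_eq_top, Submodule.map_subtype_top]
      _ ≤ C.map P.subtype ⊔ Q := by
          rw [Submodule.map_sup]
          exact sup_le_sup_left (Submodule.map_comap_le _ _) _
  · rw [Submodule.finrank_map_subtype_eq]
    exact (Submodule.quotientEquivOfIsCompl _ _ hC).finrank_eq.symm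

section MultiGr

variable {K V : Type*} [Field K] [AddCommGroup V] [Module K V] {k : ℕ}
  {F : Fin k → ℤ → Submodule K V}

theorem multiA_eq_bot {n : Fin k → ℤ} {j : Fin k} (h : F j (n j) = ⊥) : multiA K V F n = ⊥ :=
  eq_bot_iff.2 ((iInf_le _ j).trans h.le)

theorem multiA_le_multiB_of_eq_top {n : Fin k → ℤ} {j : Fin k} (h : F j (n j + 1) = ⊤) :
    multiA K V F n ≤ multiB K V F n := by
  refine le_trans (le_iInf fun i => ?_)
    (le_iSup (fun j => multiA K V F (n + Pi.single j 1)) j)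
  rcases eq_or_ne i j with rfl | hij
  · simp [h]
  · simpa [hij] using iInf_le (fun i => F i (n i)) i

theorem multiA_not_le_multiB {n : Fin k → ℤ} (h : Nontrivial (multiGr K V F n)) :
    ¬ multiA K V F n ≤ multiB K V F n := by
  rw [Submodule.Quotient.nontrivial_iff] at h
  exact fun hle => h (Submodule.comap_subtype_eq_top.2 hle)

theorem mem_Icc_of_nontrivial_multiGr (hanti : ∀ j, Antitone (F j)) {a b : Fin k → ℤ}
    (ha : ∀ j, F j (a j) = ⊤) (hb : ∀ j, F j (b j) = ⊥) {n : Fin k → ℤ}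
    (h : Nontrivial (multiGr K V F n)) : n ∈ Set.Icc a b := by
  refine ⟨fun j => ?_, fun j => ?_⟩ <;> by_contra! hj <;> refine multiA_not_le_multiB h ?_
  · exact multiA_le_multiB_of_eq_top (eq_top_iff.2 ((ha j).ge.trans (hanti j hj)))
  · rw [multiA_eq_bot (j := j) (eq_bot_iff.2 ((hanti j hj.le).trans (hb j).le))]
    exact bot_le

/-- Lifts of the multigraded pieces generate every `A(𝐧)`, by descending induction on `𝐧`. -/
theorem multiA_le_iSup (hanti : ∀ j, Antitone (F j)) {b : Fin k → ℤ} (hb : ∀ j, F j (b j) = ⊥)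
    {C : (Fin k → ℤ) → Submodule K V} (hC : ∀ n, multiA K V F n ≤ C n ⊔ multiB K V F n)
    (n : Fin k → ℤ) : multiA K V F n ≤ ⨆ m, C m := by
  induction hN : ∑ j, (b j - n j).toNat using Nat.strong_induction_on generalizing n with
  | _ N ih =>
    by_cases hn : ∃ j, b j ≤ n j
    · obtain ⟨j, hj⟩ := hn
      rw [multiA_eq_bot (j := j) (eq_bot_iff.2 ((hanti j hj).trans (hb j).le))]
      exact bot_le
    · push Not at hn
      refine (hC n).trans (sup_le (le_iSup C n) (iSup_le fun j => ih _ ?_ _ rfl))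
      rw [← hN]
      refine Finset.sum_lt_sum (fun i _ => ?_) ⟨j, Finset.mem_univ j, ?_⟩
      · rcases eq_or_ne i j with rfl | hij
        · simp only [Pi.add_apply, Pi.single_eq_same]
          omega
        · simp [hij]
      · have := hn j
        simp only [Pi.add_apply, Pi.single_eq_same]
        omega

end MultiGr

/-- for finitely many antitone exhaustive separated filtrations on a
finite-dimensional space, only finitely many multigraded pieces are nonzero, and
`dim V ≤ Σ_𝐧 dim Gr_𝐧(V)`. -/
theorem finrank_le_finsum_finrank_multiGr
    (K : Type*) [Field K] (V : Type*) [AddCommGroup V] [Module K V] [FiniteDimensional K V]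
    {k : ℕ} (F : Fin k → ℤ → Submodule K V)
    (hanti : ∀ j, Antitone (F j))
    (hexh : ∀ j, ∃ i : ℤ, F j i = ⊤)
    (hsep : ∀ j, ∃ i : ℤ, F j i = ⊥) :
    {n : Fin k → ℤ | Nontrivial (multiGr K V F n)}.Finite ∧
      Module.finrank K V ≤ ∑ᶠ n : Fin k → ℤ, Module.finrank K (multiGr K V F n) := by
  choose a ha using hexh
  choose b hb using hsep
  have hfin : {n : Fin k → ℤ | Nontrivial (multiGr K V F n)}.Finite :=
    (Set.finite_Icc a b).subset fun n hn => mem_Icc_of_nontrivial_multiGr hanti ha hb hn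
  refine ⟨hfin, ?_⟩
  have hmem (n : Fin k → ℤ) : n ∈ hfin.toFinset ↔ Module.finrank K (multiGr K V F n) ≠ 0 := by
    rw [hfin.mem_toFinset, Set.mem_ofPred_eq, ← Module.finrank_pos_iff (R := K), pos_iff_ne_zero]
  choose C hC hdim using fun n => Submodule.exists_le_sup_and_finrank_eq_quotient
    (multiA K V F n) (multiB K V F n)
  have htop : hfin.toFinset.sup C = ⊤ := by
    have h1 : multiA K V F a = ⊤ := by simp [ha]
    rw [eq_top_iff, ← h1]
    refine (multiA_le_iSup hanti hb hC a).trans (iSup_le fun n => ?_)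
    by_cases hn : n ∈ hfin.toFinset
    · exact Finset.le_sup hn
    · rw [hmem, not_not, ← hdim, Submodule.finrank_eq_zero] at hn
      simp [hn]
  rw [finsum_eq_sum_of_support_subset (s := hfin.toFinset) _ fun n hn => (hmem n).2 hn]
  calc Module.finrank K V = Module.finrank K ↥(hfin.toFinset.sup C) := by rw [htop, finrank_top]
    _ ≤ ∑ n ∈ hfin.toFinset, Module.finrank K (C n) := Submodule.finrank_finset_sup_le_sum _ _
    _ = ∑ n ∈ hfin.toFinset, Module.finrank K (multiGr K V F n) :=
      Finset.sum_congr rfl fun n _ => hdim n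
end

section
/- Let V be a two-dimensional K-vector space and let L_1, L_2, L_3 be pairwise distinct one-dimensional subspaces of V. Define three filtrations F_1, F_2, F_3 on V by F_j(i) = V for i ≤ 0, F_j(1) = L_j, and F_j(i) = 0 for i ≥ 2. Then Σ_{𝐧 ∈ ℤ³} dim_K Gr_𝐧(V) = 3; in particular the inequality dim_K V ≤ Σ_𝐧 dim_K Gr_𝐧(V) is strict for these three filtrations. -/
open TensorProduct

theorem disjoint_of_finrank_eq_one_of_ne {K V : Type*} [Field K] [AddCommGroup V] [Module K V]
    {P Q : Submodule K V} (hP : Module.finrank K P = 1) (hQ : Module.finrank K Q = 1)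
    (h : P ≠ Q) : Disjoint P Q :=
  (Submodule.isAtom_iff_finrank_eq_one.mpr hP).disjoint_of_ne
    (Submodule.isAtom_iff_finrank_eq_one.mpr hQ) h

theorem sup_eq_top_of_finrank_eq_one_of_ne {K V : Type*} [Field K] [AddCommGroup V] [Module K V]
    [FiniteDimensional K V] (h2 : Module.finrank K V = 2) {P Q : Submodule K V}
    (hP : Module.finrank K P = 1) (hQ : Module.finrank K Q = 1) (h : P ≠ Q) : P ⊔ Q = ⊤ := by
  apply Submodule.eq_top_of_finrank_eq
  have h_add := Submodule.finrank_sup_add_finrank_inf_eq P Q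
  rw [(disjoint_of_finrank_eq_one_of_ne hP hQ h).eq_bot, finrank_bot] at h_add
  omega

theorem finrank_multiGr_eq_zero_of_le {K V : Type*} [Field K] [AddCommGroup V] [Module K V]
    {k : ℕ} {F : Fin k → ℤ → Submodule K V} {n : Fin k → ℤ}
    (h : multiA K V F n ≤ multiB K V F n) : Module.finrank K (multiGr K V F n) = 0 := by
  have : Subsingleton (multiGr K V F n) :=
    Submodule.Quotient.subsingleton_iff.mpr (Submodule.comap_subtype_eq_top.mpr h)
  exact Module.finrank_zero_of_subsingleton

theorem finrank_multiGr_of_multiB_eq_bot {K V : Type*} [Field K] [AddCommGroup V] [Module K V]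
    {k : ℕ} {F : Fin k → ℤ → Submodule K V} {n : Fin k → ℤ} (h : multiB K V F n = ⊥) :
    Module.finrank K (multiGr K V F n) = Module.finrank K (multiA K V F n) := by
  have h_comap : Submodule.comap (multiA K V F n).subtype (multiB K V F n) = ⊥ := by
    rw [h, Submodule.comap_bot, Submodule.ker_subtype]
  exact (Submodule.quotEquivOfEqBot _ h_comap).finrank_eq

section LineFiltrations

variable {K V : Type*} [Field K] [AddCommGroup V] [Module K V] {k : ℕ}
  {L : Fin k → Submodule K V} {F : Fin k → ℤ → Submodule K V}

theorem multiA_single_of_lines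
    (hF : ∀ (j : Fin k) (i : ℤ), F j i = if i ≤ 0 then ⊤ else if i = 1 then L j else ⊥)
    (j : Fin k) : multiA K V F (Pi.single j 1) = L j := by
  apply le_antisymm
  · exact (iInf_le _ j).trans (by simp [hF])
  · refine le_iInf fun i => ?_
    by_cases h : i = j
    · subst h
      simp [hF]
    · simp [hF, h]

theorem multiA_eq_bot_of_two_le
    (hF : ∀ (j : Fin k) (i : ℤ), F j i = if i ≤ 0 then ⊤ else if i = 1 then L j else ⊥)
    {n : Fin k → ℤ} {i : Fin k} (hi : 2 ≤ n i) : multiA K V F n = ⊥ := by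
  refine eq_bot_iff.mpr ((iInf_le _ i).trans ?_)
  rw [hF, if_neg (by omega), if_neg (by omega)]

theorem multiA_eq_bot_of_lines
    (hL : Pairwise fun i j => Disjoint (L i) (L j))
    (hF : ∀ (j : Fin k) (i : ℤ), F j i = if i ≤ 0 then ⊤ else if i = 1 then L j else ⊥)
    {n : Fin k → ℤ} {i j : Fin k} (hij : i ≠ j) (hi : n i = 1) (hj : n j = 1) :
    multiA K V F n = ⊥ := by
  refine eq_bot_iff.mpr ((le_inf (iInf_le _ i) (iInf_le _ j)).trans ?_)
  simpa [hF, hi, hj] using (hL hij).le_bot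

theorem multiA_le_multiB_of_neg
    (hF : ∀ (j : Fin k) (i : ℤ), F j i = if i ≤ 0 then ⊤ else if i = 1 then L j else ⊥)
    {n : Fin k → ℤ} {i : Fin k} (hi : n i < 0) : multiA K V F n ≤ multiB K V F n := by
  refine le_trans (le_iInf fun j => ?_) (le_iSup (fun j => multiA K V F (n + Pi.single j 1)) i)
  by_cases h : j = i
  · subst h
    rw [hF, if_pos (by simp; omega)]
    exact le_top
  · refine (iInf_le _ j).trans ?_
    simp [h]

theorem finrank_multiGr_single_of_lines
    (hL : Pairwise fun i j => Disjoint (L i) (L j))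
    (hF : ∀ (j : Fin k) (i : ℤ), F j i = if i ≤ 0 then ⊤ else if i = 1 then L j else ⊥)
    (j : Fin k) :
    Module.finrank K (multiGr K V F (Pi.single j 1)) = Module.finrank K (L j) := by
  rw [finrank_multiGr_of_multiB_eq_bot, multiA_single_of_lines hF]
  refine iSup_eq_bot.mpr fun i => ?_
  by_cases h : i = j
  · subst h
    exact multiA_eq_bot_of_two_le hF (i := i) (by simp)
  · exact multiA_eq_bot_of_lines hL hF h (by simp [h]) (by simp [Ne.symm h])

theorem finrank_multiGr_eq_zero_of_lines
    (hL : Pairwise fun i j => Disjoint (L i) (L j)) (hL_top : ⨆ j, L j = ⊤)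
    (hF : ∀ (j : Fin k) (i : ℤ), F j i = if i ≤ 0 then ⊤ else if i = 1 then L j else ⊥)
    {n : Fin k → ℤ} (hn : ∀ j, n ≠ Pi.single j 1) :
    Module.finrank K (multiGr K V F n) = 0 := by
  apply finrank_multiGr_eq_zero_of_le
  by_cases h_neg : ∃ i, n i < 0
  · obtain ⟨i, hi⟩ := h_neg
    exact multiA_le_multiB_of_neg hF hi
  by_cases h_two : ∃ i, 2 ≤ n i
  · obtain ⟨i, hi⟩ := h_two
    exact (multiA_eq_bot_of_two_le hF hi).trans_le bot_le
  push Not at h_neg h_two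
  by_cases h_one : ∃ i, n i = 1
  · obtain ⟨i, hi⟩ := h_one
    obtain ⟨j, hj⟩ := Function.ne_iff.mp (hn i)
    have hij : j ≠ i := by
      rintro rfl
      simp [hi] at hj
    rw [Pi.single_eq_of_ne hij] at hj
    have h_j : n j = 1 := by
      have := h_neg j
      have := h_two j
      omega
    exact (multiA_eq_bot_of_lines hL hF hij h_j hi).trans_le bot_le
  · push Not at h_one
    have h_zero : n = 0 := by
      funext i
      have := h_neg i
      have := h_two i
      have := h_one i
      simp only [Pi.zero_apply]
      omega
    have h_top : multiB K V F n = ⊤ := by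
      simp only [multiB, h_zero, zero_add, multiA_single_of_lines hF, hL_top]
    exact le_top.trans_eq h_top.symm

end LineFiltrations

/-- for a 2-dimensional space with three filtrations given by three pairwise
distinct lines, the total dimension of the multigraded pieces is `3 > 2 = dim V`. -/
theorem finsum_finrank_multiGr_three_lines
    (K : Type*) [Field K] (V : Type*) [AddCommGroup V] [Module K V] [FiniteDimensional K V]
    (h2 : Module.finrank K V = 2)
    (L : Fin 3 → Submodule K V)
    (hL : ∀ j, Module.finrank K ↥(L j) = 1)
    (hdist : ∀ j j' : Fin 3, j ≠ j' → L j ≠ L j')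
    (F : Fin 3 → ℤ → Submodule K V)
    (hF : ∀ (j : Fin 3) (i : ℤ), F j i = if i ≤ 0 then ⊤ else if i = 1 then L j else ⊥) :
    (∑ᶠ n : Fin 3 → ℤ, Module.finrank K (multiGr K V F n)) = 3 ∧
      Module.finrank K V < ∑ᶠ n : Fin 3 → ℤ, Module.finrank K (multiGr K V F n) := by
  have h_disj : Pairwise fun i j => Disjoint (L i) (L j) := fun i j hij =>
    disjoint_of_finrank_eq_one_of_ne (hL i) (hL j) (hdist i j hij)
  have h_top : ⨆ j, L j = ⊤ := top_unique <|
    (sup_eq_top_of_finrank_eq_one_of_ne h2 (hL 0) (hL 1) (hdist 0 1 (by decide))).symm.trans_le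
      (sup_le (le_iSup L 0) (le_iSup L 1))
  have h_inj : Function.Injective fun j : Fin 3 => (Pi.single j 1 : Fin 3 → ℤ) := by
    intro i j hij
    by_contra h
    simpa [h] using congrFun hij i
  have h_sum : (∑ᶠ n : Fin 3 → ℤ, Module.finrank K (multiGr K V F n)) = 3 := by
    rw [finsum_eq_sum_of_support_subset (s := Finset.univ.image fun j => Pi.single j 1),
      Finset.sum_image h_inj.injOn]
    · simp [finrank_multiGr_single_of_lines h_disj hF, hL]
    · intro n hn
      contrapose! hn
      refine Function.notMem_support.mpr (finrank_multiGr_eq_zero_of_lines h_disj h_top hF ?_)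
      rintro j rfl
      simp at hn
  exact ⟨h_sum, by omega⟩
end
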